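/- Let C be a real random variable with Gaussian distribution N(μ, σ²) where σ > 0, and define the constraint violation C⁺ = max(−C, 0). Then the variance of C⁺ has the closed form Var(C⁺) = (μ² + σ²)·Φ(z) − μ·σ·φ(z) − (−μ·Φ(z) + σ·φ(z))², where z = −μ/σ. -/

import Mathlib

open MeasureTheory ProbabilityTheory Real

/-- The standard normal probability density function φ(s) = (2π)^{-1/2} exp(−s²/2). -/
noncomputable def stdNormalPDF (s : ℝ) : ℝ :=
  (Real.sqrt (2 * Real.pi))⁻¹ * Real.exp (-(s ^ 2) / 2)

/-- The standard normal cumulative distribution function Φ(t) = ∫_{−∞}^{t} φ(s) ds. -/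
noncomputable def stdNormalCDF (t : ℝ) : ℝ :=
  ∫ s in Set.Iic t, stdNormalPDF s

lemma stdNormalPDF_eq_gaussianPDFReal : stdNormalPDF = gaussianPDFReal 0 1 := by
  funext s
  simp [stdNormalPDF, gaussianPDFReal]

lemma hasDerivAt_stdNormalPDF (s : ℝ) :
    HasDerivAt stdNormalPDF (-(s * stdNormalPDF s)) s := by
  have h : HasDerivAt (fun s : ℝ => -(s ^ 2) / 2) (-s) s :=
    ((hasDerivAt_pow 2 s).neg.div_const 2).congr_deriv (by simp; ring)
  exact (h.exp.const_mul (√(2 * π))⁻¹).congr_deriv (by simp only [stdNormalPDF]; ring)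

lemma integrable_pow_mul_stdNormalPDF (n : ℕ) :
    Integrable fun s => s ^ n * stdNormalPDF s := by
  have h := integrable_rpow_mul_exp_neg_mul_sq (b := 1 / 2) (by norm_num)
    (s := n) (by linarith [n.cast_nonneg (α := ℝ)])
  refine (h.const_mul (√(2 * π))⁻¹).congr (Filter.Eventually.of_forall fun s => ?_)
  simp only [stdNormalPDF, rpow_natCast]
  rw [show -(1 / 2) * s ^ 2 = -(s ^ 2) / 2 by ring]
  ring

lemma integrable_stdNormalPDF : Integrable stdNormalPDF := by
  simpa using integrable_pow_mul_stdNormalPDF 0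

lemma integrable_mul_stdNormalPDF : Integrable fun s => s * stdNormalPDF s := by
  simpa using integrable_pow_mul_stdNormalPDF 1

lemma integral_Iic_mul_stdNormalPDF (z : ℝ) :
    ∫ s in Set.Iic z, s * stdNormalPDF s = -stdNormalPDF z := by
  have hd (s : ℝ) (_ : s ∈ Set.Iic z) := hasDerivAt_stdNormalPDF s
  have hi := integrable_mul_stdNormalPDF.neg.integrableOn (s := Set.Iic z)
  have h := integral_Iic_of_hasDerivAt_of_tendsto' hd hi
    (tendsto_zero_of_hasDerivAt_of_integrableOn_Iic hd hi integrable_stdNormalPDF.integrableOn)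
  rw [integral_neg] at h
  linarith

lemma integral_Iic_sq_mul_stdNormalPDF (z : ℝ) :
    ∫ s in Set.Iic z, s ^ 2 * stdNormalPDF s = stdNormalCDF z - z * stdNormalPDF z := by
  have hd (s : ℝ) (_ : s ∈ Set.Iic z) :
      HasDerivAt (fun s => s * stdNormalPDF s) (stdNormalPDF s - s ^ 2 * stdNormalPDF s) s :=
    ((hasDerivAt_id s).mul (hasDerivAt_stdNormalPDF s)).congr_deriv (by simp only [id]; ring)
  have h0 := integrable_stdNormalPDF.integrableOn (s := Set.Iic z)
  have h2 := (integrable_pow_mul_stdNormalPDF 2).integrableOn (s := Set.Iic z)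
  have h := integral_Iic_of_hasDerivAt_of_tendsto' hd (h0.sub h2)
    (tendsto_zero_of_hasDerivAt_of_integrableOn_Iic hd (h0.sub h2)
      integrable_mul_stdNormalPDF.integrableOn)
  rw [integral_sub h0 h2] at h
  simp only [stdNormalCDF]
  linarith

lemma integral_max_neg_pow_of_map_eq_gaussianReal {Ω : Type*} [MeasurableSpace Ω]
    {P : Measure Ω} {C : Ω → ℝ} (hC : Measurable C) {μ σ : ℝ} (hσ : 0 < σ)
    (hdist : P.map C = gaussianReal μ ⟨σ ^ 2, sq_nonneg σ⟩) {n : ℕ} (hn : n ≠ 0) :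
    ∫ ω, (max (-(C ω)) 0) ^ n ∂P
      = ∫ s in Set.Iic (-μ / σ), (-(σ * s + μ)) ^ n * stdNormalPDF s := by
  have hmap : (gaussianReal 0 1).map (fun s => σ * s + μ)
      = gaussianReal μ ⟨σ ^ 2, sq_nonneg σ⟩ := by
    have h := Measure.map_map (μ := gaussianReal 0 1) (g := fun s => s + μ)
      (f := fun s => σ * s) (by fun_prop) (by fun_prop)
    rw [gaussianReal_map_const_mul, gaussianReal_map_add_const, mul_zero, zero_add, mul_one] at h
    exact h.symm
  have hm : Measurable fun x : ℝ => (max (-x) 0) ^ n := by fun_prop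
  rw [← integral_map hC.aemeasurable (f := fun x : ℝ => (max (-x) 0) ^ n)
      hm.aestronglyMeasurable, hdist, ← hmap,
    integral_map (by fun_prop) hm.aestronglyMeasurable,
    integral_gaussianReal_eq_integral_smul one_ne_zero, ← stdNormalPDF_eq_gaussianPDFReal,
    ← integral_indicator measurableSet_Iic]
  refine integral_congr_ae (Filter.Eventually.of_forall fun s => ?_)
  by_cases hs : s ≤ -μ / σ
  · have h : 0 ≤ -(σ * s + μ) := by
      rw [le_div_iff₀ hσ] at hs
      linarith
    simp only [Set.indicator_of_mem (Set.mem_Iic.2 hs), max_eq_left h, smul_eq_mul]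
    ring
  · have h : -(σ * s + μ) ≤ 0 := by
      rw [not_le, div_lt_iff₀ hσ] at hs
      linarith
    simp only [Set.indicator_of_notMem (mt Set.mem_Iic.1 hs), max_eq_right h, zero_pow hn,
      smul_zero]

/-- If C ~ N(μ, σ²) with σ > 0 and C⁺ = max(−C, 0), then, with z = −μ/σ,
Var(C⁺) = E[(C⁺)²] − (E[C⁺])²
        = (μ² + σ²)·Φ(z) − μ·σ·φ(z) − (−μ·Φ(z) + σ·φ(z))². -/
theorem variance_constraint_violation_gaussian {Ω : Type*} [MeasurableSpace Ω]
    (P : Measure Ω) [IsProbabilityMeasure P]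
    (C : Ω → ℝ) (hC : Measurable C) (μ σ : ℝ) (hσ : 0 < σ)
    (hdist : P.map C = gaussianReal μ ⟨σ ^ 2, sq_nonneg σ⟩) :
    (∫ ω, (max (-(C ω)) 0) ^ 2 ∂P) - (∫ ω, max (-(C ω)) 0 ∂P) ^ 2
      = (μ ^ 2 + σ ^ 2) * stdNormalCDF (-μ / σ) - μ * σ * stdNormalPDF (-μ / σ)
        - (-μ * stdNormalCDF (-μ / σ) + σ * stdNormalPDF (-μ / σ)) ^ 2 := by
  have h0 := integrable_stdNormalPDF.integrableOn (s := Set.Iic (-μ / σ))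
  have h1 := integrable_mul_stdNormalPDF.integrableOn (s := Set.Iic (-μ / σ))
  have h2 := (integrable_pow_mul_stdNormalPDF 2).integrableOn (s := Set.Iic (-μ / σ))
  have hfirst : ∫ ω, max (-(C ω)) 0 ∂P
      = -μ * stdNormalCDF (-μ / σ) + σ * stdNormalPDF (-μ / σ) := by
    have h := integral_max_neg_pow_of_map_eq_gaussianReal hC hσ hdist one_ne_zero
    simp only [pow_one] at h
    rw [h]
    calc ∫ s in Set.Iic (-μ / σ), -(σ * s + μ) * stdNormalPDF s
        = ∫ s in Set.Iic (-μ / σ), (-μ * stdNormalPDF s - σ * (s * stdNormalPDF s)) := by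
          congr 1 with s
          ring
      _ = _ := by
          rw [integral_sub (h0.const_mul _) (h1.const_mul _), integral_const_mul,
            integral_const_mul, integral_Iic_mul_stdNormalPDF, stdNormalCDF]
          ring
  have hsecond : ∫ ω, (max (-(C ω)) 0) ^ 2 ∂P
      = (μ ^ 2 + σ ^ 2) * stdNormalCDF (-μ / σ) - μ * σ * stdNormalPDF (-μ / σ) := by
    rw [integral_max_neg_pow_of_map_eq_gaussianReal hC hσ hdist two_ne_zero]
    calc ∫ s in Set.Iic (-μ / σ), (-(σ * s + μ)) ^ 2 * stdNormalPDF s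
        = ∫ s in Set.Iic (-μ / σ), (μ ^ 2 * stdNormalPDF s
            + 2 * μ * σ * (s * stdNormalPDF s) + σ ^ 2 * (s ^ 2 * stdNormalPDF s)) := by
          congr 1 with s
          ring
      _ = _ := by
          rw [integral_add (by exact (h0.const_mul _).add (h1.const_mul _)) (h2.const_mul _),
            integral_add (h0.const_mul _) (h1.const_mul _), integral_const_mul,
            integral_const_mul, integral_const_mul, integral_Iic_mul_stdNormalPDF,
            integral_Iic_sq_mul_stdNormalPDF, ← stdNormalCDF]
          field_simp
          ring
  rw [hfirst, hsecond]
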